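/- Let Π be a set of policies, Π_s ⊆ Π a nonempty subset of static policies, and f, g : Π → ℝ two nonnegative welfare functions that are bounded above on Π. Suppose there exist static policies π_f, π_g ∈ Π_s attaining the global optima: f(π_f) = sup_{π ∈ Π} f(π) and g(π_g) = sup_{π ∈ Π} g(π). Then the sum-aggregated welfare satisfies sup_{π ∈ Π} (f(π) + g(π)) ≤ 2 · sup_{π ∈ Π_s} (f(π) + g(π)); that is, the Price of Anarchy of static policies for the sum objective is at most 2. -/

import Mathlib

/-- **Sum-aggregated Price of Anarchy of static policies is at most 2.**
If two nonnegative, bounded-above welfare objectives `f, g` each attain their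
global optimum at some static policy (in `Ps`), then
`sup_π (f π + g π) ≤ 2 · sup_{π ∈ Ps} (f π + g π)`. -/
theorem stmt_15 {P : Type*} (Ps : Set P) (hPs : Ps.Nonempty)
    (f g : P → ℝ) (hf0 : ∀ p, 0 ≤ f p) (hg0 : ∀ p, 0 ≤ g p)
    (hfb : BddAbove (Set.range f)) (hgb : BddAbove (Set.range g))
    (pf : P) (hpf : pf ∈ Ps) (hfopt : f pf = ⨆ p, f p)
    (pg : P) (hpg : pg ∈ Ps) (hgopt : g pg = ⨆ p, g p) :
    (⨆ p, (f p + g p)) ≤ 2 * sSup ((fun p => f p + g p) '' Ps) := by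
  have hbdd : BddAbove ((fun p => f p + g p) '' Ps) := by
    refine ⟨f pf + g pg, ?_⟩
    rintro _ ⟨p, -, rfl⟩
    rw [hfopt, hgopt]
    exact add_le_add (le_ciSup hfb p) (le_ciSup hgb p)
  have hf_static := le_csSup hbdd (Set.mem_image_of_mem _ hpf)
  have hg_static := le_csSup hbdd (Set.mem_image_of_mem _ hpg)
  have : Nonempty P := ⟨pf⟩
  refine ciSup_le fun p => ?_
  have hfp : f p ≤ f pf := hfopt ▸ le_ciSup hfb p
  have hgp : g p ≤ g pg := hgopt ▸ le_ciSup hgb p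
  linarith [hg0 pf, hf0 pg]
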